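/- In the staged construction of G₁: w.h.p. there exist no sets S, L ⊆ V such that |L| = k−1, S is a minimal L-disconnected set of G₁, and |S| < n_s. -/

import Mathlib

open scoped Classical
open Filter

noncomputable section

/-- The vertex set of the `n`-dimensional hypercube: `{0,1}^n`. -/
abbrev Vtx (n : ℕ) := Fin n → Bool

/-- The `n`-dimensional hypercube graph `Q^n`: two vertices are adjacent iff they
differ in exactly one coordinate. -/
def cubeGraph (n : ℕ) : SimpleGraph (Vtx n) :=
  SimpleGraph.fromRel (fun u v => hammingDist u v = 1)

/-- Sample space for the `k`-out model on `Q^n`: each vertex `v` chooses a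
`k`-element set of its neighbours (equivalently, `k` incident edges). -/
abbrev KOut (n k : ℕ) :=
  ∀ v : Vtx n, {s : Finset (Vtx n) // s.card = k ∧ ∀ u ∈ s, (cubeGraph n).Adj v u}

/-- The random subgraph produced by an outcome of the `k`-out model. -/
def kOutGraph (n k : ℕ) (ω : KOut n k) : SimpleGraph (Vtx n) :=
  SimpleGraph.fromRel (fun u v => v ∈ (ω u).1)

/-- Uniform (counting) probability of an event on a finite sample space. -/
def prob {Ω : Type*} [Finite Ω] (p : Ω → Prop) : ℝ :=
  (Nat.card {ω : Ω // p ω} : ℝ) / (Nat.card Ω : ℝ)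

/-- `S` is `L`-disconnected in `G`: `S` is nonempty, disjoint from `L`, and `G` has
no edge joining `S` to the vertices outside `S ∪ L`. -/
def LDisc {V : Type*} (G : SimpleGraph V) (L S : Finset V) : Prop :=
  S.Nonempty ∧ Disjoint S L ∧ ∀ u ∈ S, ∀ w : V, G.Adj u w → w ∈ S ∨ w ∈ L

/-- `S` is a minimal `L`-disconnected set of `G`: it is `L`-disconnected and no
nonempty proper subset of `S` is `L`-disconnected in `G`. -/
def MinLDisc {V : Type*} (G : SimpleGraph V) (L S : Finset V) : Prop :=
  LDisc G L S ∧ ∀ S' ⊂ S, ¬ LDisc G L S'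

/-- `k₁ = ⌈log₂ n − 2·log₂log₂ n⌉ + 1`, as an integer. -/
def kone (n : ℕ) : ℤ :=
  ⌈Real.logb 2 n - 2 * Real.logb 2 (Real.logb 2 n)⌉ + 1

/-- `n_s = 2^{k₁ − 0.1}`. -/
def nsmall (n : ℕ) : ℝ := (2 : ℝ) ^ ((kone n : ℝ) - 0.1)

/-- The set `A₀` of "active" vertices after generating `G₀` (distributed as
`Q^n(k−1)`): those lying in some minimal `L`-disconnected set of `G₀` of size at
most `n_s`, for some `L` of size `k−1`. -/
def activeSet (n k : ℕ) (ω₀ : KOut n (k - 1)) : Set (Vtx n) :=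
  {v | ∃ L S : Finset (Vtx n), L.card = k - 1 ∧
    MinLDisc (kOutGraph n (k - 1) ω₀) L S ∧ (S.card : ℝ) ≤ nsmall n ∧ v ∈ S}

/-- Sample space for the staged construction of `G₁`: an outcome of the `(k−1)`-out
model `G₀` together with, for every vertex `v`, an extra uniformly random neighbour
not among the `k−1` neighbours already chosen by `v` (only the extra choices of the
vertices of `A₀` are used to build `G₁`). -/
abbrev SpaceG1 (n k : ℕ) :=
  {p : KOut n (k - 1) × (∀ v : Vtx n, {u : Vtx n // (cubeGraph n).Adj v u}) //
    ∀ v : Vtx n, (p.2 v : Vtx n) ∉ (p.1 v : Finset (Vtx n))}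

/-- The graph `G₁`: the edges of `G₀` together with the extra edges `e_k(v)` chosen
by the vertices `v ∈ A₀`. -/
def graphG1 (n k : ℕ) (ω : SpaceG1 n k) : SimpleGraph (Vtx n) :=
  SimpleGraph.fromRel (fun u v =>
    v ∈ (ω.1.1 u : Finset (Vtx n)) ∨
      (u ∈ activeSet n k ω.1.1 ∧ (ω.1.2 u : Vtx n) = v))

/-- The number of ordered pairs `(v, w)` with `v ∈ A`, `w ∈ B` that are adjacent in `Q^n`. -/
def adjCount {n : ℕ} (A B : Finset (Vtx n)) : ℕ :=
  ∑ v ∈ A, (B.filter ((cubeGraph n).Adj v)).card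

lemma cubeGraph_adj_iff {n : ℕ} {u v : Vtx n} :
    (cubeGraph n).Adj u v ↔ hammingDist u v = 1 := by
  rw [cubeGraph, SimpleGraph.fromRel_adj, hammingDist_comm v u, or_self, and_iff_right_iff_imp]
  rintro h rfl
  simp at h

lemma eq_update_of_cubeGraph_adj {n : ℕ} {u v : Vtx n} {i : Fin n}
    (h : (cubeGraph n).Adj u v) (hi : u i ≠ v i) : v = Function.update u i (!u i) := by
  rw [cubeGraph_adj_iff, hammingDist, Finset.card_eq_one] at h
  obtain ⟨a, ha⟩ := h
  have key : ∀ j, u j ≠ v j ↔ j = a := fun j => by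
    have := Finset.ext_iff.1 ha j
    simpa using this
  obtain rfl := (key i).1 hi
  ext j
  by_cases hj : j = i
  · subst hj
    cases hu : u j <;> cases hv : v j <;> simp_all
  · rw [Function.update_of_ne hj]
    by_contra hne
    exact hj ((key j).1 fun h => hne h.symm)

lemma cubeGraph_adj_update {n : ℕ} (u : Vtx n) (i : Fin n) :
    (cubeGraph n).Adj u (Function.update u i (!u i)) := by
  rw [cubeGraph_adj_iff, hammingDist, Finset.card_eq_one]
  refine ⟨i, ?_⟩
  ext j
  by_cases hj : j = i
  · subst hj; simp
  · simp [hj]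

/-- A vertex has at most one neighbour in a set on which coordinate `i` differs from its own. -/
lemma card_filter_adj_le_one {n : ℕ} (v : Vtx n) (i : Fin n) (B : Finset (Vtx n))
    (hB : ∀ w ∈ B, v i ≠ w i) : (B.filter ((cubeGraph n).Adj v)).card ≤ 1 := by
  rw [Finset.card_le_one]
  intro x hx y hy
  rw [Finset.mem_filter] at hx hy
  rw [eq_update_of_cubeGraph_adj hx.2 (hB x hx.1), eq_update_of_cubeGraph_adj hy.2 (hB y hy.1)]

/-- Two distinct vertices of the hypercube have at most two common neighbours. -/
lemma card_common_neighbors_le_two {n : ℕ} {u v : Vtx n} (huv : u ≠ v) (B : Finset (Vtx n)) :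
    (B.filter ((cubeGraph n).Adj u) ∩ B.filter ((cubeGraph n).Adj v)).card ≤ 2 := by
  obtain ⟨i, hi⟩ := Function.ne_iff.1 huv
  refine (Finset.card_le_card (t := {Function.update u i (!u i), Function.update v i (!v i)})
    fun w hw => ?_).trans Finset.card_le_two
  simp only [Finset.mem_inter, Finset.mem_filter] at hw
  rw [Finset.mem_insert, Finset.mem_singleton]
  by_cases h : u i = w i
  · exact Or.inr (eq_update_of_cubeGraph_adj hw.2.2 fun h' => hi (h.trans h'.symm))
  · exact Or.inl (eq_update_of_cubeGraph_adj hw.1.2 h)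

lemma adjCount_comm {n : ℕ} (A B : Finset (Vtx n)) : adjCount A B = adjCount B A := by
  have := Finset.sum_card_bipartiteAbove_eq_sum_card_bipartiteBelow
    (s := A) (t := B) (cubeGraph n).Adj
  simp only [Finset.bipartiteAbove, Finset.bipartiteBelow] at this
  simp only [adjCount, this, SimpleGraph.adj_comm]

lemma adjCount_union_left {n : ℕ} {A A' : Finset (Vtx n)} (h : Disjoint A A')
    (B : Finset (Vtx n)) : adjCount (A ∪ A') B = adjCount A B + adjCount A' B :=
  Finset.sum_union h

lemma adjCount_union_right {n : ℕ} {B B' : Finset (Vtx n)} (h : Disjoint B B')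
    (A : Finset (Vtx n)) : adjCount A (B ∪ B') = adjCount A B + adjCount A B' := by
  rw [adjCount_comm, adjCount_union_left h, adjCount_comm B, adjCount_comm B']

lemma adjCount_union_self {n : ℕ} {A B : Finset (Vtx n)} (h : Disjoint A B) :
    adjCount (A ∪ B) (A ∪ B) = adjCount A A + 2 * adjCount A B + adjCount B B := by
  rw [adjCount_union_left h, adjCount_union_right h, adjCount_union_right h, adjCount_comm B A]
  ring

lemma adjCount_le_card_left {n : ℕ} (A B : Finset (Vtx n)) (i : Fin n)
    (h : ∀ v ∈ A, ∀ w ∈ B, v i ≠ w i) : adjCount A B ≤ A.card := by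
  refine (Finset.sum_le_card_nsmul A _ 1 fun v hv =>
    card_filter_adj_le_one v i B (h v hv)).trans ?_
  simp

lemma adjCount_le_min_card {n : ℕ} (A B : Finset (Vtx n)) (i : Fin n)
    (h : ∀ v ∈ A, ∀ w ∈ B, v i ≠ w i) : adjCount A B ≤ min A.card B.card :=
  le_min (adjCount_le_card_left A B i h)
    (adjCount_comm A B ▸ adjCount_le_card_left B A i fun w hw v hv => (h v hv w hw).symm)

/-- The two-point inequality behind edge isoperimetry. -/
lemma mul_logb_add_mul_logb_le {a b : ℝ} (ha : 0 < a) (hab : a ≤ b) :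
    a * Real.logb 2 a + b * Real.logb 2 b + 2 * a ≤ (a + b) * Real.logb 2 (a + b) := by
  have hb : 0 < b := ha.trans_le hab
  have hs : 0 < a + b := by positivity
  have h2 : 0 < Real.log 2 := Real.log_pos one_lt_two
  have hp : a / (a + b) ≤ 1 / 2 := by rw [div_le_div_iff₀ hs two_pos]; linarith
  have hp0 : 0 < a / (a + b) := by positivity
  have hconc := Real.strictConcave_binEntropy.concaveOn.2
    (show (0 : ℝ) ∈ Set.Icc 0 1 by norm_num) (show (2⁻¹ : ℝ) ∈ Set.Icc 0 1 by norm_num)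
    (show 0 ≤ 1 - 2 * (a / (a + b)) by linarith) (show 0 ≤ 2 * (a / (a + b)) by positivity)
    (by ring)
  simp only [smul_eq_mul, Real.binEntropy_zero, Real.binEntropy_two_inv, mul_zero, zero_add]
    at hconc
  rw [show 2 * (a / (a + b)) * 2⁻¹ = a / (a + b) by ring, Real.binEntropy,
    show 1 - a / (a + b) = b / (a + b) by field_simp; ring,
    inv_div, inv_div, Real.log_div hs.ne' ha.ne', Real.log_div hs.ne' hb.ne'] at hconc
  have h := mul_le_mul_of_nonneg_right hconc hs.le
  have e1 : 2 * (a / (a + b)) * Real.log 2 * (a + b) = 2 * a * Real.log 2 := by field_simp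
  have e2 : (a / (a + b) * (Real.log (a + b) - Real.log a) +
      b / (a + b) * (Real.log (a + b) - Real.log b)) * (a + b) =
      a * (Real.log (a + b) - Real.log a) + b * (Real.log (a + b) - Real.log b) := by field_simp
  rw [e1, e2] at h
  simp only [Real.logb]
  rw [← mul_le_mul_iff_left₀ h2]
  have e3 : (a * (Real.log a / Real.log 2) + b * (Real.log b / Real.log 2) + 2 * a) * Real.log 2 =
      a * Real.log a + b * Real.log b + 2 * a * Real.log 2 := by field_simp
  have e4 : (a + b) * (Real.log (a + b) / Real.log 2) * Real.log 2 =
      (a + b) * Real.log (a + b) := by field_simp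
  rw [e3, e4]
  linarith

/-- Edge isoperimetry in the hypercube: a set of `m` vertices spans at most `m log₂ m / 2`
edges. -/
lemma adjCount_self_le {n : ℕ} (A : Finset (Vtx n)) :
    (adjCount A A : ℝ) ≤ A.card * Real.logb 2 A.card := by
  induction A using Finset.strongInduction with
  | H A ih =>
  by_cases hA : A.card ≤ 1
  · have h0 : adjCount A A = 0 := by
      refine Finset.sum_eq_zero fun v hv => ?_
      rw [Finset.card_eq_zero, Finset.filter_eq_empty_iff]
      intro w hw hadj
      exact hadj.ne (Finset.card_le_one.1 hA v hv w hw)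
    rw [h0]
    interval_cases A.card <;> simp
  obtain ⟨u, hu, v, hv, huv⟩ := Finset.one_lt_card.1 (not_le.1 hA)
  obtain ⟨i, hi⟩ := Function.ne_iff.1 huv
  set B := A.filter fun w => w i = u i with hB
  set C := A.filter fun w => ¬ w i = u i with hC
  have hBC : Disjoint B C := Finset.disjoint_filter_filter_not ..
  have hU : B ∪ C = A := Finset.filter_union_filter_not_eq ..
  have hBA : B ⊂ A := Finset.filter_ssubset.2 ⟨v, hv, fun h => hi h.symm⟩
  have hCA : C ⊂ A := Finset.filter_ssubset.2 ⟨u, hu, by simp⟩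
  have hBpos : 0 < B.card := Finset.card_pos.2 ⟨u, by simp [hB, hu]⟩
  have hCpos : 0 < C.card := Finset.card_pos.2 ⟨v, by simp [hC, hv, Ne.symm hi]⟩
  have hcross : adjCount B C ≤ min B.card C.card := adjCount_le_min_card B C i fun x hx y hy => by
    rw [hB, Finset.mem_filter] at hx
    rw [hC, Finset.mem_filter] at hy
    exact fun h => hy.2 (h.symm.trans hx.2)
  have hcard : (A.card : ℝ) = B.card + C.card := by
    rw [← hU, Finset.card_union_of_disjoint hBC]; push_cast; rfl
  have hsplit : (adjCount A A : ℝ) = adjCount B B + 2 * adjCount B C + adjCount C C := by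
    rw [← hU, adjCount_union_self hBC]; push_cast; rfl
  have h1 : (adjCount B C : ℝ) ≤ B.card := by exact_mod_cast hcross.trans (min_le_left _ _)
  have h2 : (adjCount B C : ℝ) ≤ C.card := by exact_mod_cast hcross.trans (min_le_right _ _)
  have h3 := ih B hBA
  have h4 := ih C hCA
  rw [hsplit, hcard]
  rcases le_total (B.card : ℝ) C.card with h | h
  · linarith [mul_logb_add_mul_logb_le (by exact_mod_cast hBpos) h]
  · have := mul_logb_add_mul_logb_le (by exact_mod_cast hCpos) h
    rw [add_comm (C.card : ℝ)] at this
    linarith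

/-- If every vertex of `S` has at least `k` neighbours in `S ∪ L` and `|L| = k - 1`, then
`|S| ≥ k - 1`. -/
lemma le_card_of_le_degree {n k : ℕ} {S L : Finset (Vtx n)} (hS : S.Nonempty)
    (hSL : Disjoint S L) (hL : L.card = k - 1) (hk : 1 ≤ k)
    (hdeg : ∀ v ∈ S, k ≤ ((S ∪ L).filter ((cubeGraph n).Adj v)).card) : k - 1 ≤ S.card := by
  obtain ⟨u, hu⟩ := hS
  have hc : (S ∪ L).card = S.card + (k - 1) := by rw [Finset.card_union_of_disjoint hSL, hL]
  by_cases h1 : S.card ≤ 1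
  · have hsub : (S ∪ L).filter ((cubeGraph n).Adj u) ⊆ L := fun w hw => by
      rw [Finset.mem_filter, Finset.mem_union] at hw
      exact hw.1.resolve_left fun h => hw.2.ne (Finset.card_le_one.1 h1 u hu w h)
    have := Finset.card_le_card hsub
    have := hdeg u hu
    omega
  obtain ⟨x, hx, y, hy, hxy⟩ := Finset.one_lt_card.1 (not_le.1 h1)
  have h2 := card_common_neighbors_le_two hxy (S ∪ L)
  have h3 := Finset.card_union_add_card_inter ((S ∪ L).filter ((cubeGraph n).Adj x))
    ((S ∪ L).filter ((cubeGraph n).Adj y))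
  have h4 := Finset.card_le_card (Finset.union_subset
    (Finset.filter_subset ((cubeGraph n).Adj x) (S ∪ L))
    (Finset.filter_subset ((cubeGraph n).Adj y) (S ∪ L)))
  have := hdeg x hx
  have := hdeg y hy
  omega

/-- The numerical constraint coming from edge isoperimetry applied to `S` and `S ∪ L`. -/
lemma two_mul_card_mul_le {n k : ℕ} {S L : Finset (Vtx n)} (hSL : Disjoint S L)
    (hdeg : ∀ v ∈ S, k ≤ ((S ∪ L).filter ((cubeGraph n).Adj v)).card) :
    2 * (S.card * k : ℝ) ≤ S.card * Real.logb 2 S.card +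
      (S.card + L.card) * Real.logb 2 (S.card + L.card) := by
  have h1 : S.card * k ≤ adjCount S S + adjCount S L := by
    rw [← adjCount_union_right hSL]
    exact (smul_eq_mul ..).symm.trans_le (Finset.card_nsmul_le_sum S _ k hdeg)
  have h1' : (S.card * k : ℝ) ≤ adjCount S S + adjCount S L := by exact_mod_cast h1
  have h2 := adjCount_self_le S
  have h3 := adjCount_self_le (S ∪ L)
  rw [adjCount_union_self hSL, Finset.card_union_of_disjoint hSL] at h3
  push_cast at h3
  have h4 : (0 : ℝ) ≤ adjCount L L := by positivity
  linarith

lemma add_mul_logb_add_le {s a : ℝ} (hs : 0 < s) (ha : 0 ≤ a) (has : a ≤ s) :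
    (s + a) * Real.logb 2 (s + a) ≤ (s + a) * Real.logb 2 s + 3 * a := by
  have hl : (0.69 : ℝ) < Real.log 2 := by linarith [Real.log_two_gt_d9]
  have h1 : Real.logb 2 (s + a) = Real.logb 2 s + Real.logb 2 (1 + a / s) := by
    rw [← Real.logb_mul hs.ne' (by positivity)]
    congr 1
    field_simp
  have h2 : Real.log (1 + a / s) ≤ a / s := by
    linarith [Real.log_le_sub_one_of_pos (show 0 < 1 + a / s by positivity)]
  have h3 : Real.logb 2 (1 + a / s) ≤ 3 / 2 * (a / s) := by
    rw [Real.logb, div_le_iff₀ (by linarith)]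
    have : 0 ≤ a / s := by positivity
    nlinarith
  have h4 : (s + a) * (3 / 2 * (a / s)) ≤ 3 * a := by
    have : (s + a) * (3 / 2 * (a / s)) = 3 / 2 * a * ((s + a) / s) := by ring
    rw [this]
    have : (s + a) / s ≤ 2 := by rw [div_le_iff₀ hs]; linarith
    nlinarith
  rw [h1, mul_add]
  have := mul_le_mul_of_nonneg_left h3 (show 0 ≤ s + a by linarith)
  linarith

lemma isLittleO_logb_two_sqrt : Real.logb 2 =o[atTop] Real.sqrt := by
  have h : (fun x : ℝ => (Real.log 2)⁻¹ * Real.log x) =o[atTop] fun x : ℝ => x ^ (1 / 2 : ℝ) :=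
    (isLittleO_log_rpow_atTop (by norm_num)).const_mul_left _
  refine h.congr (fun x => ?_) fun x => (Real.sqrt_eq_rpow x).symm
  rw [Real.logb, div_eq_inv_mul]

/-- For all large `k`, no small set `S` has at least `k` neighbours per vertex in `S ∪ L` when
`|L| = k - 1`. -/
lemma eventually_not_le_degree : ∀ᶠ k : ℕ in atTop, ∀ (n : ℕ) (S L : Finset (Vtx n)),
    S.Nonempty → Disjoint S L → L.card = k - 1 → Real.logb 2 S.card < k - 0.1 →
    ¬ ∀ v ∈ S, k ≤ ((S ∪ L).filter ((cubeGraph n).Adj v)).card := by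
  have hlog : (fun x : ℝ => Real.logb 2 x + 3) =o[atTop] fun x : ℝ => Real.sqrt x :=
    isLittleO_logb_two_sqrt.add
      (Asymptotics.isLittleO_const_left.2 (Or.inr (tendsto_norm_atTop_atTop.comp
        Real.tendsto_sqrt_atTop)))
  obtain ⟨X, hX⟩ := eventually_atTop.1 (hlog.bound (show (0 : ℝ) < 1 / 5 by norm_num))
  filter_upwards [eventually_ge_atTop (⌈X⌉₊ + 4)] with k hk n S L hS hSL hL hlt hdeg
  have hks := le_card_of_le_degree hS hSL hL (by omega) hdeg
  have hmain := two_mul_card_mul_le hSL hdeg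
  have hLk : (L.card : ℝ) = k - 1 := by rw [hL, Nat.cast_sub (by omega)]; simp
  rw [hLk] at hmain
  have hks' : (k : ℝ) - 1 ≤ S.card := by
    rw [← hLk, hL]; exact_mod_cast hks
  have hk4 : (4 : ℝ) ≤ k := by exact_mod_cast (by omega : 4 ≤ k)
  set s : ℝ := (S.card : ℝ)
  set l := Real.logb 2 s with hl
  have hs3 : (3 : ℝ) ≤ s := by linarith
  have hb := add_mul_logb_add_le (a := (k : ℝ) - 1) (show 0 < s by linarith) (by linarith) hks'
  have hXs : X ≤ s := by
    have h1 : (⌈X⌉₊ : ℝ) + 4 ≤ k := by exact_mod_cast hk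
    linarith [Nat.le_ceil X]
  have hsq := hX s hXs
  have hl0 : 0 ≤ l := Real.logb_nonneg one_lt_two (by linarith)
  rw [Real.norm_of_nonneg (by linarith), Real.norm_of_nonneg (Real.sqrt_nonneg s)] at hsq
  have hsqrt := Real.sq_sqrt (show 0 ≤ s by linarith)
  have hsqrt1 : 1 ≤ Real.sqrt s := Real.one_le_sqrt.2 (by linarith)
  have hkey : 2 * s * (k - l) ≤ (k - 1) * (l + 3) := by linarith
  rcases le_total l (k / 2) with h | h
  · have h1 : s * k ≤ 2 * s * (k - l) := by nlinarith
    have h2 : s * k ≤ k * (l + 3) := by nlinarith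
    have h3 : s ≤ l + 3 := by nlinarith
    nlinarith
  · have h1 : 0.2 * s ≤ 2 * s * (k - l) := by nlinarith
    have h2 : 0.2 * s ≤ 2 * (l + 3) * (l + 3) := by nlinarith
    nlinarith

lemma tendsto_kone : Tendsto kone atTop atTop := by
  have h : Tendsto (fun y : ℝ => y - 2 * Real.logb 2 y) atTop atTop := by
    refine tendsto_atTop_mono' _ ?_ (tendsto_id.atTop_div_const two_pos)
    filter_upwards [isLittleO_logb_two_sqrt.bound (show (0 : ℝ) < 1 / 4 by norm_num),
      eventually_ge_atTop 1] with y hy hy1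
    rw [Real.norm_of_nonneg (Real.sqrt_nonneg y)] at hy
    have h1 := (le_abs_self _).trans hy
    have h2 : Real.sqrt y ≤ y := Real.sqrt_le_iff.2 ⟨by linarith, by nlinarith⟩
    simp only [id]
    linarith
  have h' := (h.comp (Real.tendsto_logb_atTop one_lt_two)).comp
    (tendsto_natCast_atTop_atTop (R := ℝ))
  refine tendsto_atTop.2 fun b => ?_
  filter_upwards [h'.eventually_ge_atTop (b : ℝ)] with n hn
  have := Int.cast_le.1 (hn.trans (Int.le_ceil _))
  simp only [Function.comp] at this
  rw [kone]
  omega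

/-- Every vertex of an `L`-disconnected set lies in a minimal one contained in it. -/
lemma LDisc.exists_minLDisc {V : Type*} {G : SimpleGraph V} {L S : Finset V} (h : LDisc G L S)
    {v : V} (hv : v ∈ S) : ∃ T ⊆ S, v ∈ T ∧ MinLDisc G L T := by
  induction S using Finset.strongInduction with
  | H S ih =>
  by_cases hmin : ∀ S' ⊂ S, ¬ LDisc G L S'
  · exact ⟨S, subset_rfl, hv, h, hmin⟩
  push Not at hmin
  obtain ⟨S', hS', h'⟩ := hmin
  by_cases hv' : v ∈ S'
  · obtain ⟨T, hT, h⟩ := ih S' hS' h' hv'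
    exact ⟨T, hT.trans hS'.subset, h⟩
  have hdiff : LDisc G L (S \ S') := by
    refine ⟨⟨v, Finset.mem_sdiff.2 ⟨hv, hv'⟩⟩, h.2.1.mono_left Finset.sdiff_subset, ?_⟩
    intro u hu w hadj
    rw [Finset.mem_sdiff] at hu ⊢
    refine (h.2.2 u hu.1 w hadj).imp_left fun hw => ⟨hw, fun hw' => ?_⟩
    rcases h'.2.2 w hw' u hadj.symm with h3 | h3
    · exact hu.2 h3
    · exact Finset.disjoint_left.1 h.2.1 hu.1 h3
  obtain ⟨T, hT, h⟩ := ih (S \ S') (Finset.sdiff_ssubset hS'.subset h'.1) hdiff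
    (Finset.mem_sdiff.2 ⟨hv, hv'⟩)
  exact ⟨T, hT.trans Finset.sdiff_subset, h⟩

lemma LDisc.mono {V : Type*} {G H : SimpleGraph V} (hGH : G ≤ H) {L S : Finset V}
    (h : LDisc H L S) : LDisc G L S :=
  ⟨h.1, h.2.1, fun u hu w hadj => h.2.2 u hu w (hGH hadj)⟩

lemma kOutGraph_le_graphG1 {n k : ℕ} (ω : SpaceG1 n k) :
    kOutGraph n (k - 1) ω.1.1 ≤ graphG1 n k ω := by
  intro u v h
  rw [kOutGraph, SimpleGraph.fromRel_adj] at h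
  rw [graphG1, SimpleGraph.fromRel_adj]
  exact ⟨h.1, h.2.imp Or.inl Or.inl⟩

/-- All vertices of a small `L`-disconnected set of `G₁` with `|L| = k - 1` are active. -/
lemma LDisc.mem_activeSet {n k : ℕ} {ω : SpaceG1 n k} {L S : Finset (Vtx n)}
    (h : LDisc (graphG1 n k ω) L S) (hL : L.card = k - 1) (hS : (S.card : ℝ) ≤ nsmall n)
    {v : Vtx n} (hv : v ∈ S) : v ∈ activeSet n k ω.1.1 := by
  obtain ⟨T, hTS, hvT, hT⟩ := (h.mono (kOutGraph_le_graphG1 ω)).exists_minLDisc hv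
  exact ⟨L, T, hL, hT, le_trans (by exact_mod_cast Finset.card_le_card hTS) hS, hvT⟩

/-- In a small `L`-disconnected set of `G₁`, all `k` choices of every vertex stay in `S ∪ L`. -/
lemma LDisc.le_degree {n k : ℕ} (hk : 1 ≤ k) {ω : SpaceG1 n k} {L S : Finset (Vtx n)}
    (h : LDisc (graphG1 n k ω) L S) (hL : L.card = k - 1) (hS : (S.card : ℝ) ≤ nsmall n)
    {v : Vtx n} (hv : v ∈ S) : k ≤ ((S ∪ L).filter ((cubeGraph n).Adj v)).card := by
  have hact := h.mem_activeSet hL hS hv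
  have hcard : (insert (ω.1.2 v : Vtx n) (ω.1.1 v : Finset (Vtx n))).card = k := by
    rw [Finset.card_insert_of_notMem (ω.2 v), (ω.1.1 v).2.1]
    omega
  rw [← hcard]
  refine Finset.card_le_card fun w hw => ?_
  rw [Finset.mem_insert] at hw
  have hadj : (cubeGraph n).Adj v w := by
    rcases hw with rfl | hw
    · exact (ω.1.2 v).2
    · exact (ω.1.1 v).2.2 w hw
  have hG : (graphG1 n k ω).Adj v w := by
    rw [graphG1, SimpleGraph.fromRel_adj]
    exact ⟨hadj.ne, Or.inl (hw.symm.imp_right fun h => ⟨hact, h.symm⟩)⟩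
  rw [Finset.mem_filter, Finset.mem_union]
  exact ⟨h.2.2 v hv w hG, hadj⟩

lemma nonempty_spaceG1 {n k : ℕ} (hk : 1 ≤ k) (hkn : k ≤ n) : Nonempty (SpaceG1 n k) := by
  have key : ∀ v : Vtx n, ∃ (s : Finset (Vtx n)) (u : Vtx n), u ∉ s ∧ s.card = k - 1 ∧
      (∀ w ∈ s, (cubeGraph n).Adj v w) ∧ (cubeGraph n).Adj v u := by
    intro v
    have hinj : Function.Injective fun i => Function.update v i (!v i) := by
      intro i j hij
      by_contra hne
      have := congrFun hij i
      simp [Function.update_of_ne hne] at this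
    obtain ⟨t, ht, htc⟩ := Finset.exists_subset_card_eq
      (s := Finset.univ.image fun i => Function.update v i (!v i)) (n := k)
      (by rw [Finset.card_image_of_injective _ hinj]; simpa using hkn)
    have hadj : ∀ w ∈ t, (cubeGraph n).Adj v w := fun w hw => by
      obtain ⟨i, -, rfl⟩ := Finset.mem_image.1 (ht hw)
      exact cubeGraph_adj_update v i
    obtain ⟨u, hu⟩ := Finset.card_pos.1 (show 0 < t.card by omega)
    exact ⟨t.erase u, u, Finset.notMem_erase u t, by rw [Finset.card_erase_of_mem hu, htc],
      fun w hw => hadj w (Finset.mem_of_mem_erase hw), hadj u hu⟩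
  choose s u h using key
  exact ⟨⟨(fun v => ⟨s v, (h v).2.1, (h v).2.2.1⟩, fun v => ⟨u v, (h v).2.2.2⟩),
    fun v => (h v).1⟩⟩

lemma prob_eq_one {Ω : Type*} [Finite Ω] [Nonempty Ω] {p : Ω → Prop} (h : ∀ ω, p ω) :
    prob p = 1 := by
  rw [prob, Nat.card_congr (Equiv.subtypeUnivEquiv h), div_self]
  exact_mod_cast Nat.card_pos.ne'

/-- Staged construction, small sets: if `k₁ ≤ k(n) ≤ n−1` (for all large `n`), then
w.h.p. there are no sets `S, L ⊆ V` with `|L| = k−1`, `S` a minimal `L`-disconnected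
set of `G₁`, and `|S| < n_s`. -/
theorem stmt_16 (k : ℕ → ℕ)
    (hk : ∀ᶠ n : ℕ in atTop, kone n ≤ (k n : ℤ) ∧ k n ≤ n - 1) :
    Tendsto (fun n : ℕ =>
        prob (fun ω : SpaceG1 n (k n) =>
          ¬ ∃ S L : Finset (Vtx n), L.card = k n - 1 ∧
              MinLDisc (graphG1 n (k n) ω) L S ∧ (S.card : ℝ) < nsmall n))
      atTop (nhds 1) := by
  have hkn : ∀ᶠ n : ℕ in atTop, ∀ m : ℕ, kone n ≤ (m : ℤ) → 1 ≤ m ∧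
      ∀ (S L : Finset (Vtx n)), S.Nonempty → Disjoint S L → L.card = m - 1 →
        Real.logb 2 S.card < m - 0.1 →
        ¬ ∀ v ∈ S, m ≤ ((S ∪ L).filter ((cubeGraph n).Adj v)).card := by
    obtain ⟨K, hK⟩ := eventually_atTop.1 eventually_not_le_degree
    filter_upwards [tendsto_kone.eventually_ge_atTop ((K : ℤ) + 1)] with n hn m hm
    exact ⟨by omega, hK m (by omega) n⟩
  refine tendsto_const_nhds.congr' ?_
  filter_upwards [hk, hkn] with n hn hdet
  obtain ⟨hk1, hnot⟩ := hdet (k n) hn.1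
  have := nonempty_spaceG1 hk1 (show k n ≤ n by omega)
  refine (prob_eq_one fun ω => ?_).symm
  rintro ⟨S, L, hL, hmin, hS⟩
  refine hnot S L hmin.1.1 hmin.1.2.1 hL ?_ fun v hv => hmin.1.le_degree hk1 hL hS.le hv
  have hpos : (0 : ℝ) < S.card := by exact_mod_cast Finset.card_pos.2 hmin.1.1
  rw [Real.logb_lt_iff_lt_rpow one_lt_two hpos]
  refine hS.trans_le (Real.rpow_le_rpow_of_exponent_le one_le_two ?_)
  have : (kone n : ℝ) ≤ k n := by exact_mod_cast hn.1
  linarith
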